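/- arXiv:2505.19109 — 2 statements merged into one kernel-verified Lean document; each statement's English description precedes it below -/
import Mathlib

section
/- Let R > 0, let 0 < r₁ ≤ r₁' ≤ R and 0 < r₂ ≤ R with r₁ + r₂ ≥ R. Then θ_R(r₁', r₂) ≤ θ_R(r₁, r₂); that is, on the region {(r₁, r₂) : 0 < r₁, r₂ ≤ R, r₁ + r₂ ≥ R} the angle function θ_R is nonincreasing in each of its two arguments. -/
open Real

/-- The angle function `θ_R(r₁, r₂)`. -/
noncomputable def thetaR (R r₁ r₂ : ℝ) : ℝ :=
  Real.arccos ((Real.cosh r₁ * Real.cosh r₂ - Real.cosh R) / (Real.sinh r₁ * Real.sinh r₂))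

/-- `sinh` is superadditive on nonnegative reals. -/
theorem Real.sinh_add_sinh_le_sinh_add {x y : ℝ} (hx : 0 ≤ x) (hy : 0 ≤ y) :
    Real.sinh x + Real.sinh y ≤ Real.sinh (x + y) := by
  rw [Real.sinh_add]
  have h₁ := le_mul_of_one_le_right (Real.sinh_nonneg_iff.2 hx) (Real.one_le_cosh y)
  have h₂ := le_mul_of_one_le_left (Real.sinh_nonneg_iff.2 hy) (Real.one_le_cosh x)
  linarith

/-- On the region `{(r₁, r₂) : 0 < r₁, r₂ ≤ R, r₁ + r₂ ≥ R}` the angle function `θ_R`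
is nonincreasing in each of its two arguments: increasing the first radius can only
decrease the angle. -/
theorem thetaR_antitone_left (R r₁ r₁' r₂ : ℝ) (hR : 0 < R)
    (hr₁ : 0 < r₁) (h₁₁' : r₁ ≤ r₁') (hr₁'R : r₁' ≤ R)
    (hr₂ : 0 < r₂) (hr₂R : r₂ ≤ R) (hsum : R ≤ r₁ + r₂) :
    thetaR R r₁' r₂ ≤ thetaR R r₁ r₂ := by
  have hs₁ : 0 < Real.sinh r₁ := Real.sinh_pos_iff.2 hr₁
  have hs₁' : 0 < Real.sinh r₁' := Real.sinh_pos_iff.2 (hr₁.trans_le h₁₁')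
  have hs₂ : 0 < Real.sinh r₂ := Real.sinh_pos_iff.2 hr₂
  have hcosh : Real.cosh r₂ ≤ Real.cosh R := by
    rwa [Real.cosh_le_cosh, abs_of_pos hr₂, abs_of_pos hR]
  have hsuper := Real.sinh_add_sinh_le_sinh_add hr₁.le (sub_nonneg.2 h₁₁')
  rw [add_sub_cancel] at hsuper
  have hsub : Real.sinh (r₁' - r₁) ≤ Real.sinh r₁' - Real.sinh r₁ := by linarith
  have key : Real.cosh r₂ * Real.sinh (r₁' - r₁) ≤
      Real.cosh R * (Real.sinh r₁' - Real.sinh r₁) :=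
    mul_le_mul hcosh hsub (Real.sinh_nonneg_iff.2 (sub_nonneg.2 h₁₁')) (Real.cosh_pos R).le
  rw [Real.sinh_sub] at key
  refine Real.arccos_le_arccos ?_
  rw [div_le_div_iff₀ (mul_pos hs₁ hs₂) (mul_pos hs₁' hs₂)]
  linarith [mul_le_mul_of_nonneg_right key hs₂.le]
end

section
/- There exists an absolute constant R₀ such that for all R ≥ R₀ and all r₁, r₂ ∈ (0, R] with r₁ + r₂ ≥ R, one has e^{(R − r₁ − r₂)/2} ≤ θ_R(r₁, r₂) ≤ π·e^{(R − r₁ − r₂)/2}; in particular θ_R(r₁, r₂) = Θ(1)·e^{(R − r₁ − r₂)/2} with explicit constants 1 and π. -/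
open Real

theorem sinh_eq_exp_mul_one_sub (r : ℝ) : sinh r = exp r / 2 * (1 - exp (-r) ^ 2) := by
  rw [sinh_eq, exp_neg]
  field_simp

theorem cosh_sub_cosh_eq_exp_mul (R d : ℝ) :
    cosh R - cosh d = exp R / 2 * ((1 - exp (-(R + d))) * (1 - exp (-(R - d)))) := by
  rw [cosh_eq, cosh_eq, neg_sub, sub_eq_add_neg d R, neg_add, exp_add, exp_add, exp_neg, exp_neg]
  field_simp
  ring

/-- The quantity `1 - cos θ_R(r₁, r₂)` lies between `e^{R - r₁ - r₂} / 2` and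
`2 e^{R - r₁ - r₂}`. -/
theorem one_sub_cos_arg_bounds {R r₁ r₂ : ℝ} (h₁ : 0 < r₁) (h₁R : r₁ ≤ R) (h₂ : 0 < r₂)
    (h₂R : r₂ ≤ R) (hR : R ≤ r₁ + r₂) :
    exp ((R - r₁ - r₂) / 2) ^ 2 / 2 ≤
        1 - (cosh r₁ * cosh r₂ - cosh R) / (sinh r₁ * sinh r₂) ∧
      1 - (cosh r₁ * cosh r₂ - cosh R) / (sinh r₁ * sinh r₂) ≤
        2 * exp ((R - r₁ - r₂) / 2) ^ 2 := by
  have hs₁ : 0 < sinh r₁ := sinh_pos_iff.2 h₁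
  have hs₂ : 0 < sinh r₂ := sinh_pos_iff.2 h₂
  have hs : 0 < sinh r₁ * sinh r₂ := mul_pos hs₁ hs₂
  have hc : 1 - (cosh r₁ * cosh r₂ - cosh R) / (sinh r₁ * sinh r₂) =
      (cosh R - cosh (r₁ - r₂)) / (sinh r₁ * sinh r₂) := by
    rw [cosh_sub]
    field_simp
    ring
  have ht : exp ((R - r₁ - r₂) / 2) ^ 2 * (exp r₁ * exp r₂) = exp R := by
    rw [← exp_nat_mul, ← exp_add, ← exp_add]
    congr 1
    push_cast
    ring
  have ha : exp (-r₁) < 1 := Real.exp_lt_one_iff.2 (by linarith)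
  have hb : exp (-r₂) < 1 := Real.exp_lt_one_iff.2 (by linarith)
  have ha0 := exp_pos (-r₁)
  have hb0 := exp_pos (-r₂)
  have hp : exp (-(R + (r₁ - r₂))) ≤ exp (-r₁) := exp_le_exp.2 (by linarith)
  have hq : exp (-(R - (r₁ - r₂))) ≤ exp (-r₂) := exp_le_exp.2 (by linarith)
  have hp' : exp (-r₁) ^ 2 ≤ exp (-(R + (r₁ - r₂))) := by
    rw [← exp_nat_mul]
    exact exp_le_exp.2 (by push_cast; linarith)
  have hq' : exp (-r₂) ^ 2 ≤ exp (-(R - (r₁ - r₂))) := by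
    rw [← exp_nat_mul]
    exact exp_le_exp.2 (by push_cast; linarith)
  have hE := exp_pos R
  rw [hc, le_div_iff₀ hs, div_le_iff₀ hs, cosh_sub_cosh_eq_exp_mul, sinh_eq_exp_mul_one_sub r₁,
    sinh_eq_exp_mul_one_sub r₂]
  generalize exp (-(R + (r₁ - r₂))) = p at *
  generalize exp (-(R - (r₁ - r₂))) = q at *
  generalize exp (-r₁) = a at *
  generalize exp (-r₂) = b at *
  have hlow : (1 - a ^ 2) / 2 * ((1 - b ^ 2) / 2) ≤ (1 - p) * (1 - q) :=
    mul_le_mul (by nlinarith) (by nlinarith) (by nlinarith) (by linarith)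
  have hupp : (1 - p) * (1 - q) ≤ (1 - a ^ 2) * (1 - b ^ 2) :=
    mul_le_mul (by linarith) (by linarith) (by linarith) (by nlinarith)
  constructor
  · calc _ = exp ((R - r₁ - r₂) / 2) ^ 2 * (exp r₁ * exp r₂) / 2 *
          ((1 - a ^ 2) / 2 * ((1 - b ^ 2) / 2)) := by ring
      _ ≤ _ := by rw [ht]; gcongr
  · calc _ ≤ exp R / 2 * ((1 - a ^ 2) * (1 - b ^ 2)) := by gcongr
      _ = _ := by rw [← ht]; ring

/-- For all sufficiently large `R` and all `r₁, r₂ ∈ (0, R]` with `r₁ + r₂ ≥ R`,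
the angle function satisfies
`e^{(R - r₁ - r₂)/2} ≤ θ_R(r₁, r₂) ≤ π · e^{(R - r₁ - r₂)/2}`. -/
theorem thetaR_asymptotics :
    ∃ R₀ : ℝ, ∀ R : ℝ, R₀ ≤ R → ∀ r₁ r₂ : ℝ,
      0 < r₁ → r₁ ≤ R → 0 < r₂ → r₂ ≤ R → R ≤ r₁ + r₂ →
      Real.exp ((R - r₁ - r₂) / 2) ≤ thetaR R r₁ r₂ ∧
        thetaR R r₁ r₂ ≤ π * Real.exp ((R - r₁ - r₂) / 2) := by
  refine ⟨0, fun R _ r₁ r₂ h₁ h₁R h₂ h₂R hR => ?_⟩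
  obtain ⟨hlow, hupp⟩ := one_sub_cos_arg_bounds h₁ h₁R h₂ h₂R hR
  have ht0 : 0 < exp ((R - r₁ - r₂) / 2) := exp_pos _
  have ht1 : exp ((R - r₁ - r₂) / 2) ≤ 1 := exp_le_one_iff.2 (by linarith)
  unfold thetaR
  generalize (cosh r₁ * cosh r₂ - cosh R) / (sinh r₁ * sinh r₂) = c at *
  generalize exp ((R - r₁ - r₂) / 2) = t at *
  have hcos : cos (arccos c) = c := cos_arccos (by nlinarith) (by nlinarith)
  have hθ0 := arccos_nonneg c
  have hθπ := arccos_le_pi c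
  generalize arccos c = θ at *
  constructor
  · have h := one_sub_sq_div_two_le_cos (x := θ)
    exact (sq_le_sq₀ ht0.le hθ0).1 (by linarith)
  · have h := cos_le_one_sub_mul_cos_sq (x := θ) (by rwa [abs_of_nonneg hθ0])
    have h' : 2 / π ^ 2 * θ ^ 2 ≤ 2 * t ^ 2 := by linarith
    refine (sq_le_sq₀ hθ0 (by positivity)).1 ?_
    field_simp at h'
    linarith
end
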